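/- arXiv:nlin/0511062 — 5 statements merged into one kernel-verified Lean document; each statement's English description precedes it below -/
import Mathlib

section
/- Fix σ ∈ {1,…,n−1}. For every i ∈ {σ+1,…,n} there exist an integer N ≥ 0 and a smooth function Φ_i : (ℝ^{σ+n−i})^{N+1} → ℝ such that for every smooth curve q : ℝ → ℝ^n and every x ∈ ℝ: E_i(L^{n,0,2n+σ})[q](x) = −2·q_{σ+n−i+1}(x) + Φ_i( q̄(x), q̄'(x), …, q̄^{(N)}(x) ), where q̄ = (q_1,…,q_{σ+n−i}) and q_α is read as 0 for α > n. In other words, the i-th Euler–Lagrange expression of L^{n,0,2n+σ} equals −2q_{σ+n−i+1} plus a differential expression involving only q_1,…,q_{σ+n−i} and their x-derivatives. -/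
open scoped BigOperators

/-- Coordinate of `q` with the conventions `q₀ = 1` and `q_α = 0` for `α < 0` or `α > n`
(1-based indexing by an integer). -/
def qc (n : ℕ) (q : Fin n → ℝ) (r : ℤ) : ℝ :=
  if r = 0 then 1
  else if h : 1 ≤ r ∧ r ≤ (n : ℤ) then q ⟨(r - 1).toNat, by omega⟩ else 0

/-- The Benenti potentials `V_r^{(k)}` in `n` variables. -/
noncomputable def benenti (n : ℕ) (r k : ℤ) (q : Fin n → ℝ) : ℝ :=
  if r < 1 ∨ (n : ℤ) < r then 0
  else if k = 0 then (if r = (n : ℤ) then 1 else 0)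
  else if 0 < k then
    benenti n (r + 1) (k - 1) q - qc n q r * benenti n 1 (k - 1) q
  else
    benenti n (r - 1) (k + 1) q - (qc n q (r - 1) / qc n q n) * benenti n n (k + 1) q
termination_by k.natAbs
decreasing_by all_goals omega

/-- Partial derivative of `f` with respect to the `i`-th coordinate at `q`. -/
noncomputable def pd {n : ℕ} (f : (Fin n → ℝ) → ℝ) (i : Fin n) (q : Fin n → ℝ) : ℝ :=
  deriv (fun t => f (Function.update q i t)) (q i)

/-- Euler–Lagrange expression `E_l(L)[c](x)` of a Lagrangian density `L(q,p)`
along a curve `c`. -/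
noncomputable def elExpr {n : ℕ} (L : (Fin n → ℝ) → (Fin n → ℝ) → ℝ) (l : Fin n)
    (c : ℝ → Fin n → ℝ) (x : ℝ) : ℝ :=
  pd (fun vq => L vq (deriv c x)) l (c x)
    - deriv (fun y => pd (fun vp => L (c y) vp) l (deriv c y)) x

/-- The Lagrangian density `L^{n,m,k}`. -/
noncomputable def lag (n : ℕ) (m k : ℤ) (q p : Fin n → ℝ) : ℝ :=
  (1 / 2) * ∑ i : Fin n, ∑ j : Fin n,
      benenti n 1 (2 * (n : ℤ) - m - ((i : ℕ) + 1) - ((j : ℕ) + 1)) q * p i * p j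
    - benenti n 1 k q

/-- The matrix `L` of the Benenti class in Viète coordinates. -/
def Lmat (n : ℕ) (q : Fin n → ℝ) : Matrix (Fin n) (Fin n) ℝ :=
  Matrix.of fun i j => if (j : ℕ) = 0 then -q i else if (j : ℕ) = (i : ℕ) + 1 then 1 else 0

open PowerSeries in
noncomputable def hq (Q : ℕ → ℝ) (m : ℕ) : ℝ := coeff m (PowerSeries.mk Q)⁻¹

open PowerSeries in
noncomputable def gq (Q : ℕ → ℝ) (m : ℕ) : ℝ := coeff m ((PowerSeries.mk Q)⁻¹ * (PowerSeries.mk Q)⁻¹)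

noncomputable def dq (Q Q' : ℕ → ℝ) (m : ℕ) : ℝ :=
  - ∑ p ∈ Finset.HasAntidiagonal.antidiagonal m, Q' p.1 * gq Q p.2

lemma mk_hq (Q : ℕ → ℝ) : PowerSeries.mk (hq Q) = (PowerSeries.mk Q)⁻¹ := by
  ext m; simp [hq]

lemma mk_gq (Q : ℕ → ℝ) : PowerSeries.mk (gq Q) = (PowerSeries.mk Q)⁻¹ * (PowerSeries.mk Q)⁻¹ := by
  ext m; simp [gq]

lemma mk_dq (Q Q' : ℕ → ℝ) : PowerSeries.mk (dq Q Q') = - (PowerSeries.mk Q' * PowerSeries.mk (gq Q)) := by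
  ext m; simp [dq, PowerSeries.coeff_mul]

lemma mkQ_cancel (Q : ℕ → ℝ) (h0 : Q 0 = 1) : PowerSeries.mk Q * (PowerSeries.mk Q)⁻¹ = 1 := by
  apply PowerSeries.mul_inv_cancel
  simp [← PowerSeries.coeff_zero_eq_constantCoeff_apply, h0]

lemma mul_rec (Q F B : ℕ → ℝ) (h0 : Q 0 = 1)
    (h : PowerSeries.mk Q * PowerSeries.mk F = PowerSeries.mk B) (m : ℕ) :
    F (m+1) = B (m+1) - ∑ p ∈ Finset.HasAntidiagonal.antidiagonal m, Q (p.1+1) * F p.2 := by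
  have := congrArg (PowerSeries.coeff (m+1)) h
  simp only [PowerSeries.coeff_mul, PowerSeries.coeff_mk, Finset.Nat.sum_antidiagonal_succ, h0] at this
  linarith

lemma hq_zero (Q : ℕ → ℝ) (h0 : Q 0 = 1) : hq Q 0 = 1 := by
  have := congrArg (PowerSeries.coeff 0) (mkQ_cancel Q h0)
  rw [← mk_hq] at this
  simpa [PowerSeries.coeff_mul, h0] using this

lemma gq_zero (Q : ℕ → ℝ) (h0 : Q 0 = 1) : gq Q 0 = 1 := by
  have := hq_zero Q h0
  have h2 : gq Q 0 = hq Q 0 * hq Q 0 := by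
    rw [gq, ← mk_hq]; simp [PowerSeries.coeff_mul]
  rw [h2, this]; norm_num

lemma hq_succ (Q : ℕ → ℝ) (h0 : Q 0 = 1) (m : ℕ) :
    hq Q (m+1) = - ∑ p ∈ Finset.HasAntidiagonal.antidiagonal m, Q (p.1+1) * hq Q p.2 := by
  have := mul_rec Q (hq Q) (fun m => if m = 0 then 1 else 0) h0 (by
    rw [mk_hq, mkQ_cancel Q h0]; ext m; simp [PowerSeries.coeff_one]) m
  simpa using this

lemma gq_succ (Q : ℕ → ℝ) (h0 : Q 0 = 1) (m : ℕ) :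
    gq Q (m+1) = hq Q (m+1) - ∑ p ∈ Finset.HasAntidiagonal.antidiagonal m, Q (p.1+1) * gq Q p.2 := by
  apply mul_rec Q (gq Q) (hq Q) h0
  rw [mk_hq, mk_gq, ← mul_assoc, mkQ_cancel Q h0, one_mul]

lemma dq_succ (Q Q' : ℕ → ℝ) (h0 : Q 0 = 1) (h0' : Q' 0 = 0) (m : ℕ) :
    dq Q Q' (m+1) = - ∑ p ∈ Finset.HasAntidiagonal.antidiagonal m, Q' (p.1+1) * hq Q p.2
      - ∑ p ∈ Finset.HasAntidiagonal.antidiagonal m, Q (p.1+1) * dq Q Q' p.2 := by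
  have := mul_rec Q (dq Q Q') (fun m => - ∑ p ∈ Finset.HasAntidiagonal.antidiagonal m, Q' p.1 * hq Q p.2) h0 (by
    have : PowerSeries.mk (fun m => - ∑ p ∈ Finset.HasAntidiagonal.antidiagonal m, Q' p.1 * hq Q p.2)
      = - (PowerSeries.mk Q' * PowerSeries.mk (hq Q)) := by
      ext m; simp [PowerSeries.coeff_mul]
    rw [this, mk_dq, mk_gq, mk_hq]
    linear_combination (-PowerSeries.mk Q' * (PowerSeries.mk Q)⁻¹) * mkQ_cancel Q h0) m
  rw [this, Finset.Nat.sum_antidiagonal_succ, h0']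
  simp

lemma hq_hasDerivAt (Q : ℝ → ℕ → ℝ) (Q' : ℕ → ℝ) (x : ℝ) (h0 : ∀ y, Q y 0 = 1) (h0' : Q' 0 = 0)
    (hQ : ∀ j, HasDerivAt (fun y => Q y j) (Q' j) x) (m : ℕ) :
    HasDerivAt (fun y => hq (Q y) m) (dq (Q x) Q' m) x := by
  induction m using Nat.strong_induction_on with
  | _ m ih =>
    cases m with
    | zero =>
      simp only [hq_zero _ (h0 _)]
      simpa [dq, h0'] using hasDerivAt_const x (1:ℝ)
    | succ m =>
      simp only [hq_succ _ (h0 _)]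
      rw [dq_succ _ _ (h0 x) h0']
      have : HasDerivAt (fun y => - ∑ p ∈ Finset.HasAntidiagonal.antidiagonal m, Q y (p.1+1) * hq (Q y) p.2)
        (- ∑ p ∈ Finset.HasAntidiagonal.antidiagonal m, (Q' (p.1+1) * hq (Q x) p.2 + Q x (p.1+1) * dq (Q x) Q' p.2)) x := by
        apply HasDerivAt.fun_neg
        apply HasDerivAt.fun_sum
        intro p hp
        have := Finset.HasAntidiagonal.mem_antidiagonal.1 hp
        exact (hQ _).fun_mul (ih p.2 (by omega))
      convert this using 1
      rw [Finset.sum_add_distrib]; ring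

lemma hq_contDiff {E : Type*} [NormedAddCommGroup E] [NormedSpace ℝ E] (Q : E → ℕ → ℝ)
    (h0 : ∀ y, Q y 0 = 1) (hQ : ∀ j, ContDiff ℝ (⊤ : ℕ∞) (fun y => Q y j)) (m : ℕ) :
    ContDiff ℝ (⊤ : ℕ∞) (fun y => hq (Q y) m) := by
  induction m using Nat.strong_induction_on with
  | _ m ih =>
    cases m with
    | zero =>
      simp only [hq_zero _ (h0 _)]
      exact contDiff_const
    | succ m =>
      simp only [hq_succ _ (h0 _)]
      apply ContDiff.neg
      apply ContDiff.sum
      intro p hp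
      have := Finset.HasAntidiagonal.mem_antidiagonal.1 hp
      exact (hQ _).mul (ih p.2 (by omega))

lemma gq_eq (Q : ℕ → ℝ) (m : ℕ) : gq Q m = ∑ p ∈ Finset.HasAntidiagonal.antidiagonal m, hq Q p.1 * hq Q p.2 := by
  rw [gq, PowerSeries.coeff_mul]; rfl

lemma gq_contDiff {E : Type*} [NormedAddCommGroup E] [NormedSpace ℝ E] (Q : E → ℕ → ℝ)
    (h0 : ∀ y, Q y 0 = 1) (hQ : ∀ j, ContDiff ℝ (⊤ : ℕ∞) (fun y => Q y j)) (m : ℕ) :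
    ContDiff ℝ (⊤ : ℕ∞) (fun y => gq (Q y) m) := by
  simp only [gq_eq]
  exact ContDiff.sum fun p _ => (hq_contDiff Q h0 hQ _).mul (hq_contDiff Q h0 hQ _)

lemma dq_contDiff {E : Type*} [NormedAddCommGroup E] [NormedSpace ℝ E] (Q Q' : E → ℕ → ℝ)
    (h0 : ∀ y, Q y 0 = 1) (hQ : ∀ j, ContDiff ℝ (⊤ : ℕ∞) (fun y => Q y j))
    (hQ' : ∀ j, ContDiff ℝ (⊤ : ℕ∞) (fun y => Q' y j)) (m : ℕ) :
    ContDiff ℝ (⊤ : ℕ∞) (fun y => dq (Q y) (Q' y) m) := by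
  simp only [dq]
  exact (ContDiff.sum fun p _ => (hQ' _).mul (gq_contDiff Q h0 hQ _)).neg

lemma hq_congr (Q Z : ℕ → ℝ) (h0 : Q 0 = 1) (m : ℕ) (h : ∀ j ≤ m, Q j = Z j) :
    hq Q m = hq Z m := by
  have hz : Z 0 = 1 := by rw [← h 0 (by omega), h0]
  induction m using Nat.strong_induction_on with
  | _ m ih =>
    cases m with
    | zero => rw [hq_zero _ h0, hq_zero _ hz]
    | succ m =>
      rw [hq_succ _ h0, hq_succ _ hz]
      congr 1
      apply Finset.sum_congr rfl
      intro p hp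
      have := Finset.HasAntidiagonal.mem_antidiagonal.1 hp
      rw [h _ (by omega), ih p.2 (by omega) (fun j hj => h j (by omega))]

lemma gq_congr (Q Z : ℕ → ℝ) (h0 : Q 0 = 1) (m : ℕ) (h : ∀ j ≤ m, Q j = Z j) :
    gq Q m = gq Z m := by
  rw [gq_eq, gq_eq]
  apply Finset.sum_congr rfl
  intro p hp
  have := Finset.HasAntidiagonal.mem_antidiagonal.1 hp
  rw [hq_congr Q Z h0 p.1 fun j hj => h j (by omega), hq_congr Q Z h0 p.2 fun j hj => h j (by omega)]

lemma dq_congr (Q Z Q' Z' : ℕ → ℝ) (h0 : Q 0 = 1) (m : ℕ) (h : ∀ j ≤ m, Q j = Z j)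
    (h' : ∀ j ≤ m, Q' j = Z' j) : dq Q Q' m = dq Z Z' m := by
  rw [dq, dq]
  congr 1
  apply Finset.sum_congr rfl
  intro p hp
  have := Finset.HasAntidiagonal.mem_antidiagonal.1 hp
  rw [gq_congr Q Z h0 p.2 fun j hj => h j (by omega), h' _ (by omega)]

lemma sum_diff (Q Z F F' : ℕ → ℝ) (k : ℕ) (h : ∀ j ≤ k, Q j = Z j) (hF : ∀ j ≤ k, F j = F' j) :
    ∑ p ∈ Finset.HasAntidiagonal.antidiagonal k, Q (p.1+1) * F p.2
      = ∑ p ∈ Finset.HasAntidiagonal.antidiagonal k, Z (p.1+1) * F' p.2 + (Q (k+1) - Z (k+1)) * F 0 := by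
  rw [← sub_eq_iff_eq_add', ← Finset.sum_sub_distrib]
  rw [Finset.sum_eq_single (k, 0)]
  · rw [hF 0 (by omega)]; ring
  · rintro ⟨a, b⟩ hp hne
    have := Finset.HasAntidiagonal.mem_antidiagonal.1 hp
    simp only [ne_eq, Prod.mk.injEq] at hne this ⊢
    rw [h (a+1) (by omega), hF b (by omega)]; ring
  · simp

lemma gq_diff (Q Z : ℕ → ℝ) (h0 : Q 0 = 1) (k : ℕ) (h : ∀ j ≤ k, Q j = Z j) (hZ : Z (k+1) = 0) :
    gq Q (k+1) = -2 * Q (k+1) + gq Z (k+1) := by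
  have hz : Z 0 = 1 := by rw [← h 0 (by omega), h0]
  rw [gq_succ _ h0, gq_succ _ hz, hq_succ _ h0, hq_succ _ hz,
    sum_diff Q Z (hq Q) (hq Z) k h (fun j hj => hq_congr Q Z h0 j fun i hi => h i (by omega)),
    sum_diff Q Z (gq Q) (gq Z) k h (fun j hj => gq_congr Q Z h0 j fun i hi => h i (by omega)),
    hq_zero _ h0, gq_zero _ h0, hZ]
  ring

lemma qc_zero (n : ℕ) (q : Fin n → ℝ) : qc n q 0 = 1 := by simp [qc]

lemma benenti_unroll (n : ℕ) (q : Fin n → ℝ) (k r : ℕ) (hr : 1 ≤ r) :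
    benenti n r k q = (if r + k = n then 1 else 0)
      - ∑ j ∈ Finset.range k, qc n q ((r + j : ℕ) : ℤ) * benenti n 1 ((k - 1 - j : ℕ) : ℤ) q := by
  induction k generalizing r with
  | zero =>
    rw [benenti]
    simp
    grind
  | succ k ih =>
    by_cases hrn : n < r
    · rw [benenti, if_pos (by omega), if_neg (by omega), Finset.sum_eq_zero]
      · simp
      intro j _
      have : qc n q ((r + j : ℕ) : ℤ) = 0 := by
        rw [qc, if_neg (by omega), dif_neg (by omega)]
      rw [this, zero_mul]
    · rw [benenti, if_neg (by omega), if_neg (by omega), if_pos (by omega)]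
      have e1 : (r : ℤ) + 1 = ((r + 1 : ℕ) : ℤ) := by push_cast; ring
      have e2 : ((k + 1 : ℕ) : ℤ) - 1 = (k : ℤ) := by push_cast; ring
      rw [e1, e2, ih (r+1) (by omega), Finset.sum_range_succ']
      have e3 : (r + 1 + k = n) = (r + (k + 1) = n) := by apply propext; omega
      simp only [e3]
      have : ∀ j, qc n q ((r + 1 + j : ℕ) : ℤ) * benenti n 1 ((k - 1 - j : ℕ) : ℤ) q
         = qc n q ((r + (j + 1) : ℕ) : ℤ) * benenti n 1 ((k + 1 - 1 - (j + 1) : ℕ) : ℤ) q := by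
        intro j
        rw [show r + 1 + j = r + (j+1) by ring, show k + 1 - 1 - (j+1) = k - 1 - j by omega]
      simp only [this]
      simp
      ring

lemma benenti_eq (n : ℕ) (hn : 1 ≤ n) (q : Fin n → ℝ) (k : ℕ) :
    benenti n 1 k q = if n - 1 ≤ k then hq (fun j => qc n q (j : ℤ)) (k - (n - 1)) else 0 := by
  have key : PowerSeries.mk (fun j : ℕ => qc n q (j : ℤ)) * PowerSeries.mk (fun k : ℕ => benenti n 1 k q)
      = PowerSeries.X ^ (n-1) := by
    ext k
    rw [PowerSeries.coeff_mul, PowerSeries.coeff_X_pow]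
    simp only [PowerSeries.coeff_mk]
    have := benenti_unroll n q k 1 le_rfl
    rw [Finset.Nat.sum_antidiagonal_eq_sum_range_succ (fun a b => qc n q (a:ℤ) * benenti n 1 (b:ℤ) q),
      Finset.sum_range_succ']
    have e : (1 + k = n) = (k = n - 1) := by apply propext; omega
    simp only [e] at this
    have e2 : ∀ j, qc n q ((1 + j : ℕ) : ℤ) * benenti n 1 ((k - 1 - j : ℕ) : ℤ) q
       = qc n q ((j + 1 : ℕ) : ℤ) * benenti n 1 ((k - (j + 1) : ℕ) : ℤ) q := by
      intro j
      rw [show 1 + j = j+1 by ring, show k - (j+1) = k - 1 - j by omega]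
    simp only [e2] at this
    rw [← eq_sub_iff_add_eq', ← this]
    simp [qc_zero]
  have h1 := mkQ_cancel (fun j : ℕ => qc n q (j : ℤ)) (by simp [qc_zero])
  have : PowerSeries.mk (fun k : ℕ => benenti n 1 k q)
      = PowerSeries.X ^ (n-1) * PowerSeries.mk (hq (fun j : ℕ => qc n q (j : ℤ))) := by
    rw [mk_hq, ← key]
    linear_combination (- PowerSeries.mk (fun k : ℕ => benenti n 1 k q)) * h1
  have := congrArg (PowerSeries.coeff k) this
  simpa [PowerSeries.coeff_X_pow_mul'] using this

/-- extension of a vector to a sequence, with prescribed zeroth entry -/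
def ext0 (d : ℕ) (z : ℝ) (w : Fin d → ℝ) (j : ℕ) : ℝ :=
  if j = 0 then z else if h : j - 1 < d then w ⟨j - 1, h⟩ else 0

lemma qc_eq_ext0 (n : ℕ) (q : Fin n → ℝ) : (fun j : ℕ => qc n q (j : ℤ)) = ext0 n 1 q := by
  funext j
  unfold qc ext0
  by_cases hj : j = 0
  · simp [hj]
  · rw [if_neg (by omega), if_neg hj]
    by_cases h : j - 1 < n
    · rw [dif_pos (by omega), dif_pos h]
      congr 2
      omega
    · rw [dif_neg (by omega), dif_neg h]

lemma dq_delta (Q : ℕ → ℝ) (i m : ℕ) :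
    dq Q (fun j => if j = i then 1 else 0) m = if i ≤ m then - gq Q (m - i) else 0 := by
  have h1 : PowerSeries.mk (fun j => if j = i then (1:ℝ) else 0) = PowerSeries.X ^ i := by
    ext j; simp [PowerSeries.coeff_X_pow]
  have := congrArg (PowerSeries.coeff m) (mk_dq Q (fun j => if j = i then 1 else 0))
  rw [h1] at this
  simp only [PowerSeries.coeff_mk, map_neg, PowerSeries.coeff_X_pow_mul'] at this
  rw [this]; split_ifs <;> simp

def wq (n : ℕ) (f : ℕ → ℝ) (a b : ℕ) : ℝ := if a + b ≤ n - 1 then f (n - 1 - a - b) else 0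

lemma lag_eq (n : ℕ) (hn : 1 ≤ n) (σ : ℕ) (q p : Fin n → ℝ) :
    lag n 0 (2 * (n : ℤ) + σ) q p =
      (1/2) * ∑ a : Fin n, ∑ b : Fin n, wq n (hq (ext0 n 1 q)) a b * p a * p b
        - hq (ext0 n 1 q) (n + 1 + σ) := by
  unfold lag
  congr 1
  · congr 1
    refine Finset.sum_congr rfl fun a _ => Finset.sum_congr rfl fun b _ => ?_
    have ha := a.isLt
    have hb := b.isLt
    rw [show 2 * (n : ℤ) - 0 - ((a : ℕ) + 1) - ((b : ℕ) + 1) = ((2 * n - 2 - a - b : ℕ) : ℤ) by omega,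
      benenti_eq n hn, qc_eq_ext0, wq]
    congr 2
    by_cases h : (a : ℕ) + b ≤ n - 1
    · rw [if_pos (by omega), if_pos h]; congr 1; omega
    · rw [if_neg (by omega), if_neg h]
  · rw [show 2 * (n : ℤ) + σ = ((2 * n + σ : ℕ) : ℤ) by push_cast; ring, benenti_eq n hn, qc_eq_ext0,
      if_pos (by omega)]
    congr 1; omega

lemma ext0_zero (d : ℕ) (z : ℝ) (w : Fin d → ℝ) : ext0 d z w 0 = z := by simp [ext0]

lemma ext0_hasDerivAt (n : ℕ) (z : ℝ) (c : ℝ → Fin n → ℝ) (c' : Fin n → ℝ) (x : ℝ)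
    (h : ∀ j, HasDerivAt (fun y => c y j) (c' j) x) (j : ℕ) :
    HasDerivAt (fun y => ext0 n z (c y) j) (ext0 n 0 c' j) x := by
  unfold ext0
  split_ifs
  · exact hasDerivAt_const _ _
  · exact h _
  · exact hasDerivAt_const _ _

lemma ext0_contDiff {E : Type*} [NormedAddCommGroup E] [NormedSpace ℝ E] (n : ℕ) (z : ℝ)
    (c : E → Fin n → ℝ) (h : ∀ j, ContDiff ℝ (⊤ : ℕ∞) (fun y => c y j)) (j : ℕ) :
    ContDiff ℝ (⊤ : ℕ∞) (fun y => ext0 n z (c y) j) := by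
  unfold ext0
  split_ifs
  · exact contDiff_const
  · exact h _
  · exact contDiff_const

lemma wq_hasDerivAt (n : ℕ) (f : ℝ → ℕ → ℝ) (f' : ℕ → ℝ) (x : ℝ)
    (h : ∀ j, HasDerivAt (fun y => f y j) (f' j) x) (a b : ℕ) :
    HasDerivAt (fun y => wq n (f y) a b) (wq n f' a b) x := by
  unfold wq
  split_ifs
  · exact h _
  · exact hasDerivAt_const _ _

lemma wq_contDiff {E : Type*} [NormedAddCommGroup E] [NormedSpace ℝ E] (n : ℕ)
    (f : E → ℕ → ℝ) (h : ∀ j, ContDiff ℝ (⊤ : ℕ∞) (fun y => f y j)) (a b : ℕ) :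
    ContDiff ℝ (⊤ : ℕ∞) (fun y => wq n (f y) a b) := by
  unfold wq
  split_ifs
  · exact h _
  · exact contDiff_const

lemma update_hasDerivAt (n : ℕ) (q : Fin n → ℝ) (l j : Fin n) (x : ℝ) :
    HasDerivAt (fun t => Function.update q l t j) (if j = l then 1 else 0) x := by
  by_cases h : j = l
  · subst h; simpa using hasDerivAt_id' x
  · simpa [h] using hasDerivAt_const x (q j)

lemma hq_ext0_hasDerivAt (n : ℕ) (c : ℝ → Fin n → ℝ) (c' : Fin n → ℝ) (x : ℝ)
    (h : ∀ j, HasDerivAt (fun y => c y j) (c' j) x) (m : ℕ) :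
    HasDerivAt (fun y => hq (ext0 n 1 (c y)) m) (dq (ext0 n 1 (c x)) (ext0 n 0 c') m) x :=
  hq_hasDerivAt (fun y => ext0 n 1 (c y)) _ x (fun _ => ext0_zero _ _ _) (ext0_zero _ _ _)
    (ext0_hasDerivAt n 1 c c' x h) m

lemma ext0_delta (n : ℕ) (l : Fin n) :
    ext0 n 0 (fun j => if j = l then 1 else 0) = fun j : ℕ => if j = (l : ℕ) + 1 then 1 else 0 := by
  funext j
  have := l.isLt
  unfold ext0
  simp only [Fin.ext_iff]
  split_ifs <;> first | rfl | omega

noncomputable def dd (Q : ℕ → ℝ) (i m : ℕ) : ℝ := if i ≤ m then - gq Q (m - i) else 0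

lemma pd_q (n : ℕ) (hn : 1 ≤ n) (σ : ℕ) (q p : Fin n → ℝ) (l : Fin n) :
    pd (fun vq => lag n 0 (2 * (n : ℤ) + σ) vq p) l q =
      (1/2) * ∑ a : Fin n, ∑ b : Fin n, wq n (dd (ext0 n 1 q) (l+1)) a b * p a * p b
        - dd (ext0 n 1 q) (l+1) (n + 1 + σ) := by
  unfold pd
  simp only [lag_eq n hn]
  apply HasDerivAt.deriv
  have key : ∀ m, HasDerivAt (fun t => hq (ext0 n 1 (Function.update q l t)) m)
      (dd (ext0 n 1 q) (l+1) m) (q l) := by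
    intro m
    have := hq_ext0_hasDerivAt n (fun t => Function.update q l t) _ (q l)
      (fun j => update_hasDerivAt n q l j (q l)) m
    rw [ext0_delta, dq_delta, Function.update_eq_self] at this
    exact this
  refine HasDerivAt.fun_sub ?_ (key _)
  refine HasDerivAt.const_mul _ ?_
  refine HasDerivAt.fun_sum fun a _ => HasDerivAt.fun_sum fun b _ => ?_
  refine HasDerivAt.mul_const (HasDerivAt.mul_const ?_ _) _
  exact wq_hasDerivAt n (fun t => hq (ext0 n 1 (Function.update q l t))) _ _ key a b

lemma wq_comm (n : ℕ) (f : ℕ → ℝ) (a b : ℕ) : wq n f a b = wq n f b a := by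
  unfold wq
  rw [add_comm a b, Nat.sub_right_comm]

lemma pd_p (n : ℕ) (hn : 1 ≤ n) (σ : ℕ) (q p : Fin n → ℝ) (l : Fin n) :
    pd (fun vp => lag n 0 (2 * (n : ℤ) + σ) q vp) l p =
      ∑ b : Fin n, wq n (hq (ext0 n 1 q)) l b * p b := by
  unfold pd
  simp only [lag_eq n hn]
  apply HasDerivAt.deriv
  have : HasDerivAt (fun t => (1/2) * ∑ a : Fin n, ∑ b : Fin n, wq n (hq (ext0 n 1 q)) a b *
      Function.update p l t a * Function.update p l t b - hq (ext0 n 1 q) (n + 1 + σ))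
      ((1/2) * ∑ a : Fin n, ∑ b : Fin n, ((wq n (hq (ext0 n 1 q)) a b * (if a = l then 1 else 0))
        * Function.update p l (p l) b +
        wq n (hq (ext0 n 1 q)) a b * Function.update p l (p l) a * (if b = l then 1 else 0)))  (p l) := by
    refine HasDerivAt.sub_const _ ?_
    refine HasDerivAt.const_mul _ ?_
    refine HasDerivAt.fun_sum fun a _ => HasDerivAt.fun_sum fun b _ => ?_
    exact ((update_hasDerivAt n p l a (p l)).const_mul _).fun_mul (update_hasDerivAt n p l b (p l))
  refine this.congr_deriv ?_
  simp only [Function.update_eq_self, Finset.sum_add_distrib]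
  have e1 : ∑ a : Fin n, ∑ b : Fin n, wq n (hq (ext0 n 1 q)) a b * (if a = l then 1 else 0) * p b
      = ∑ b : Fin n, wq n (hq (ext0 n 1 q)) l b * p b := by
    rw [Finset.sum_comm]
    simp
  have e2 : ∑ a : Fin n, ∑ b : Fin n, wq n (hq (ext0 n 1 q)) a b * p a * (if b = l then 1 else 0)
      = ∑ b : Fin n, wq n (hq (ext0 n 1 q)) l b * p b := by
    simp
    exact Finset.sum_congr rfl fun b _ => by rw [wq_comm]
  rw [e1, e2]; ring

lemma el_eq (n : ℕ) (hn : 1 ≤ n) (σ : ℕ) (c : ℝ → Fin n → ℝ) (hc : ContDiff ℝ (⊤ : ℕ∞) c)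
    (l : Fin n) (x : ℝ) :
    elExpr (lag n 0 (2 * (n : ℤ) + σ)) l c x =
      (1/2) * ∑ a : Fin n, ∑ b : Fin n, wq n (dd (ext0 n 1 (c x)) (l+1)) a b
          * iteratedDeriv 1 (fun y => c y a) x * iteratedDeriv 1 (fun y => c y b) x
        - dd (ext0 n 1 (c x)) (l+1) (n + 1 + σ)
      - ∑ b : Fin n,
        (wq n (dq (ext0 n 1 (c x)) (ext0 n 0 (fun j => iteratedDeriv 1 (fun y => c y j) x))) l b
            * iteratedDeriv 1 (fun y => c y b) x
          + wq n (hq (ext0 n 1 (c x))) l b * iteratedDeriv 2 (fun y => c y b) x) := by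
  have hcj : ∀ j, ContDiff ℝ (⊤ : ℕ∞) (fun y => c y j) := fun j => (contDiff_pi.1 hc) j
  have hd1 : ∀ j y, HasDerivAt (fun y => c y j) (iteratedDeriv 1 (fun y => c y j) y) y := by
    intro j y
    rw [iteratedDeriv_one]
    exact ((hcj j).differentiable (by simp) y).hasDerivAt
  have hd : ∀ y j, deriv c y j = iteratedDeriv 1 (fun y => c y j) y := by
    intro y j
    have : HasDerivAt c (fun j => iteratedDeriv 1 (fun y => c y j) y) y :=
      hasDerivAt_pi.2 fun j => hd1 j y
    rw [this.deriv]
  have hd2 : ∀ j y, HasDerivAt (fun y => iteratedDeriv 1 (fun y => c y j) y)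
      (iteratedDeriv 2 (fun y => c y j) y) y := by
    intro j y
    rw [iteratedDeriv_succ (n := 1)]
    exact ((hcj j).differentiable_iteratedDeriv 1 (by norm_cast) y).hasDerivAt
  unfold elExpr
  simp only [pd_q n hn, pd_p n hn, hd]
  congr 1
  apply HasDerivAt.deriv
  refine HasDerivAt.fun_sum fun b _ => ?_
  refine HasDerivAt.fun_mul ?_ (hd2 b x)
  exact wq_hasDerivAt n (fun t => hq (ext0 n 1 (c t))) _ _
    (hq_ext0_hasDerivAt n c _ x (fun j => hd1 j x)) _ _

noncomputable def bigPhi (n σ i d : ℕ) (w : Fin 3 → Fin d → ℝ) : ℝ :=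
  (1/2) * ∑ a : Fin n, ∑ b : Fin n, wq n (dd (ext0 d 1 (w 0)) i) a b
          * ext0 d 0 (w 1) (a+1) * ext0 d 0 (w 1) (b+1)
        - dd (ext0 d 1 (w 0)) i (n + 1 + σ)
      - ∑ b : Fin n,
        (wq n (dq (ext0 d 1 (w 0)) (ext0 d 0 (w 1))) (i-1) b * ext0 d 0 (w 1) (b+1)
          + wq n (hq (ext0 d 1 (w 0))) (i-1) b * ext0 d 0 (w 2) (b+1))

lemma bigPhi_contDiff (n σ i d : ℕ) : ContDiff ℝ (⊤ : ℕ∞) (bigPhi n σ i d) := by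
  have hw : ∀ (k : Fin 3) (j : Fin d), ContDiff ℝ (⊤ : ℕ∞) (fun w : Fin 3 → Fin d → ℝ => w k j) := by
    intro k j; fun_prop
  have he : ∀ (k : Fin 3) (z : ℝ) (j : ℕ),
      ContDiff ℝ (⊤ : ℕ∞) (fun w : Fin 3 → Fin d → ℝ => ext0 d z (w k) j) :=
    fun k z j => ext0_contDiff d z (fun w : Fin 3 → Fin d → ℝ => w k) (hw k) j
  have hdd : ∀ m, ContDiff ℝ (⊤ : ℕ∞) (fun w : Fin 3 → Fin d → ℝ => dd (ext0 d 1 (w 0)) i m) := by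
    intro m
    unfold dd
    split_ifs
    · exact (gq_contDiff (fun w : Fin 3 → Fin d → ℝ => ext0 d 1 (w 0)) (fun _ => ext0_zero _ _ _) (he 0 1) _).neg
    · exact contDiff_const
  unfold bigPhi
  refine ContDiff.sub (ContDiff.sub (contDiff_const.mul ?_) (hdd _)) ?_
  · refine ContDiff.sum fun a _ => ContDiff.sum fun b _ => ?_
    exact ((wq_contDiff n (fun w : Fin 3 → Fin d → ℝ => dd (ext0 d 1 (w 0)) i) hdd _ _).mul (he _ _ _)).mul (he _ _ _)
  · refine ContDiff.sum fun b _ => ContDiff.add (ContDiff.mul ?_ (he _ _ _)) (ContDiff.mul ?_ (he _ _ _))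
    · exact wq_contDiff n (fun w : Fin 3 → Fin d → ℝ => dq (ext0 d 1 (w 0)) (ext0 d 0 (w 1)))
        (dq_contDiff (fun w : Fin 3 → Fin d → ℝ => ext0 d 1 (w 0)) (fun w => ext0 d 0 (w 1))
          (fun _ => ext0_zero _ _ _) (he _ _) (he _ _)) _ _
    · exact wq_contDiff n (fun w : Fin 3 → Fin d → ℝ => hq (ext0 d 1 (w 0)))
        (hq_contDiff (fun w : Fin 3 → Fin d → ℝ => ext0 d 1 (w 0))
          (fun _ => ext0_zero _ _ _) (he _ _)) _ _

lemma ext0_restrict (n d : ℕ) (z : ℝ) (hd : d ≤ n) (q : Fin n → ℝ) (j : ℕ) (hj : j ≤ d) :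
    ext0 n z q j = ext0 d z (fun k : Fin d => q ⟨k, by have := k.isLt; omega⟩) j := by
  unfold ext0
  split_ifs <;> first | rfl | omega

/-- fix `σ ∈ {1,…,n−1}`. For every `i ∈ {σ+1,…,n}` there exist `N ∈ ℕ`
and a smooth function `Φᵢ : (ℝ^{σ+n−i})^{N+1} → ℝ` such that for every smooth curve
`q : ℝ → ℝ^n` and every `x`:
`E_i(L^{n,0,2n+σ})[q](x) = −2·q_{σ+n−i+1}(x) + Φᵢ(q̄(x), q̄'(x), …, q̄^{(N)}(x))`,
where `q̄ = (q₁,…,q_{σ+n−i})`. -/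
theorem el_positive_elimination_structure
    (n : ℕ) (hn : 1 ≤ n) (σ : ℕ) (hσ1 : 1 ≤ σ) (hσ2 : σ ≤ n - 1)
    (i : ℕ) (hi1 : σ + 1 ≤ i) (hi2 : i ≤ n) :
    ∃ (N : ℕ) (Φ : (Fin (N + 1) → Fin (σ + n - i) → ℝ) → ℝ),
      ContDiff ℝ (⊤ : ℕ∞) Φ ∧
      ∀ c : ℝ → Fin n → ℝ, ContDiff ℝ (⊤ : ℕ∞) c → ∀ x : ℝ,
        elExpr (lag n 0 (2 * (n : ℤ) + σ)) ⟨i - 1, by omega⟩ c x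
          = -2 * c x ⟨σ + n - i, by omega⟩
            + Φ (fun m j =>
                iteratedDeriv (m : ℕ) (fun y => c y ⟨(j : ℕ), by have := j.isLt; omega⟩) x) := by
  obtain ⟨d, hd⟩ : ∃ d, d = σ + n - i := ⟨_, rfl⟩
  subst_vars
  refine ⟨2, bigPhi n σ i (σ + n - i), bigPhi_contDiff _ _ _ _, ?_⟩
  intro c hc x
  rw [el_eq n hn σ c hc]
  have hQ : ∀ j ≤ σ + n - i, ext0 n 1 (c x) j = ext0 (σ + n - i) 1
      (fun k : Fin (σ + n - i) => c x ⟨k, by have := k.isLt; omega⟩) j :=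
    fun j hj => ext0_restrict n _ 1 (by omega) (c x) j hj
  have hQ' : ∀ m, ∀ j ≤ σ + n - i, ext0 n 0 (fun j => iteratedDeriv m (fun y => c y j) x) j
      = ext0 (σ + n - i) 0 (fun k : Fin (σ + n - i) =>
        iteratedDeriv m (fun y => c y ⟨k, by have := k.isLt; omega⟩) x) j :=
    fun m j hj => ext0_restrict n _ 0 (by omega) (fun j => iteratedDeriv m (fun y => c y j) x) j hj
  have hP : ∀ m (b : Fin n), (b : ℕ) < σ + n - i → iteratedDeriv m (fun y => c y b) x
      = ext0 (σ + n - i) 0 (fun k : Fin (σ + n - i) =>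
        iteratedDeriv m (fun y => c y ⟨k, by have := k.isLt; omega⟩) x) (b + 1) := by
    intro m b hb
    simp [ext0, hb]
  have h01 : ext0 n 1 (c x) 0 = 1 := ext0_zero _ _ _
  have hl : i - 1 + 1 = i := by omega
  unfold bigPhi
  simp only [hl, Fin.val_zero, Fin.val_one, Fin.val_two, iteratedDeriv_zero]
  have T1 : ∀ a b : Fin n, wq n (dd (ext0 n 1 (c x)) i) a b
          * iteratedDeriv 1 (fun y => c y a) x * iteratedDeriv 1 (fun y => c y b) x
      = wq n (dd (ext0 (σ + n - i) 1
      (fun k : Fin (σ + n - i) => c x ⟨k, by have := k.isLt; omega⟩)) i) a b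
          * ext0 (σ + n - i) 0 (fun k : Fin (σ + n - i) =>
        iteratedDeriv 1 (fun y => c y ⟨k, by have := k.isLt; omega⟩) x) (a + 1)
          * ext0 (σ + n - i) 0 (fun k : Fin (σ + n - i) =>
        iteratedDeriv 1 (fun y => c y ⟨k, by have := k.isLt; omega⟩) x) (b + 1) := by
    intro a b
    unfold wq dd
    by_cases h1 : (a : ℕ) + b ≤ n - 1
    · by_cases h2 : i ≤ n - 1 - a - b
      · rw [hP 1 a (by omega), hP 1 b (by omega), gq_congr _ _ h01 _ (fun j hj => hQ j (by omega))]
      · simp [h2]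
    · simp [h1]
  have T2 : dd (ext0 n 1 (c x)) i (n + 1 + σ) = 2 * c x ⟨σ + n - i, by omega⟩
      + dd (ext0 (σ + n - i) 1
        (fun k : Fin (σ + n - i) => c x ⟨k, by have := k.isLt; omega⟩)) i (n + 1 + σ) := by
    unfold dd
    rw [if_pos (by omega), if_pos (by omega), show n + 1 + σ - i = σ + n - i + 1 by omega,
      gq_diff _ _ h01 _ hQ (by simp [ext0])]
    have : ext0 n 1 (c x) (σ + n - i + 1) = c x ⟨σ + n - i, by omega⟩ := by
      unfold ext0
      rw [if_neg (by omega), dif_pos (by omega)]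
      rfl
    rw [this]; ring
  have T3 : ∀ b : Fin n, 
        (wq n (dq (ext0 n 1 (c x)) (ext0 n 0 (fun j => iteratedDeriv 1 (fun y => c y j) x))) (i-1) b
            * iteratedDeriv 1 (fun y => c y b) x
          + wq n (hq (ext0 n 1 (c x))) (i-1) b * iteratedDeriv 2 (fun y => c y b) x)
      = wq n (dq (ext0 (σ + n - i) 1
      (fun k : Fin (σ + n - i) => c x ⟨k, by have := k.isLt; omega⟩)) (ext0 (σ + n - i) 0 (fun k : Fin (σ + n - i) =>
        iteratedDeriv 1 (fun y => c y ⟨k, by have := k.isLt; omega⟩) x))) (i-1) b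
          * ext0 (σ + n - i) 0 (fun k : Fin (σ + n - i) =>
        iteratedDeriv 1 (fun y => c y ⟨k, by have := k.isLt; omega⟩) x) (b + 1)
          + wq n (hq (ext0 (σ + n - i) 1
      (fun k : Fin (σ + n - i) => c x ⟨k, by have := k.isLt; omega⟩))) (i-1) b
          * ext0 (σ + n - i) 0 (fun k : Fin (σ + n - i) =>
        iteratedDeriv 2 (fun y => c y ⟨k, by have := k.isLt; omega⟩) x) (b + 1) := by
    intro b
    unfold wq
    by_cases h1 : i - 1 + (b : ℕ) ≤ n - 1
    · rw [hP 1 b (by omega), hP 2 b (by omega), hq_congr _ _ h01 _ (fun j hj => hQ j (by omega)),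
        dq_congr _ _ _ _ h01 _ (fun j hj => hQ j (by omega)) (fun j hj => hQ' 1 j (by omega))]
    · simp [h1]
  simp only [T1, T2, T3]
  ring
end

section
/- Let q = (q_i)_{i≥1} be a family of smooth real functions on ℝ and for r ≥ 1 define the family Z_r[q] by (Z_r[q])_j(x) = q_{j+r−1}'(x) + Σ_{k=1}^{j−1} ( q_k(x)·q_{j+r−k−1}'(x) − q_{j+r−k−1}(x)·q_k'(x) ) for j ≥ 1 (each component is a polynomial expression in finitely many of the q_i and their first derivatives, so Z_r[q] is again a family of smooth functions). Then the infinite Killing hierarchy commutes: for all i,j ≥ 1, every component l ≥ 1 and every x ∈ ℝ, (d/dε)|_{ε=0} ( Z_i[q + ε·Z_j[q]] )_l(x) = (d/dε)|_{ε=0} ( Z_j[q + ε·Z_i[q]] )_l(x). -/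
open scoped BigOperators

/-- The `j`-th component of the `r`-th vector field `Z_r[q]` of the infinite Killing
(universal) hierarchy in Viète coordinates:
`(Z_r[q])_j = q_{j+r−1}' + Σ_{k=1}^{j−1} (q_k·q_{j+r−k−1}' − q_{j+r−k−1}·q_k')`. -/
noncomputable def Zfield (q : ℕ → ℝ → ℝ) (r j : ℕ) (x : ℝ) : ℝ :=
  deriv (q (j + r - 1)) x
    + ∑ k ∈ Finset.Icc 1 (j - 1),
        (q k x * deriv (q (j + r - k - 1)) x - q (j + r - k - 1) x * deriv (q k) x)

namespace KillingAux

/-- projection on exponents `≤ 0` -/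
noncomputable def P (f : HahnSeries ℤ ℝ) : HahnSeries ℤ ℝ where
  coeff e := if e ≤ 0 then f.coeff e else 0
  isPWO_support' := f.isPWO_support.mono (by
    intro e he
    simp only [Function.mem_support, ne_eq, ite_eq_right_iff, Classical.not_imp] at he
    exact he.2)

lemma P_coeff (f : HahnSeries ℤ ℝ) (e : ℤ) :
    (P f).coeff e = if e ≤ 0 then f.coeff e else 0 := rfl

lemma P_add (f g : HahnSeries ℤ ℝ) : P (f + g) = P f + P g := by
  ext e; simp only [P_coeff, HahnSeries.coeff_add]; split_ifs <;> simp

lemma P_sub (f g : HahnSeries ℤ ℝ) : P (f - g) = P f - P g := by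
  ext e; simp only [P_coeff, HahnSeries.coeff_sub]; split_ifs <;> simp

lemma mul_coeff_zero (f g : HahnSeries ℤ ℝ) (e : ℤ)
    (h : ∀ a b, a + b = e → f.coeff a = 0 ∨ g.coeff b = 0) : (f * g).coeff e = 0 := by
  by_contra hne
  have := HahnSeries.support_mul_subset (x := f) (y := g) (show e ∈ (f * g).support from hne)
  obtain ⟨a, ha, b, hb, hab⟩ := Set.mem_add.1 this
  rcases h a b hab with h | h
  · exact ha h
  · exact hb h

lemma P_mul_pos (f g : HahnSeries ℤ ℝ) : P (P f * P g) = P f * P g := by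
  ext e
  rw [P_coeff]
  split_ifs with h
  · rfl
  · symm
    apply mul_coeff_zero
    intro a b hab
    simp only [P_coeff]
    by_cases ha : a ≤ 0
    · right; rw [if_neg]; omega
    · left; rw [if_neg ha]

lemma P_mul_neg (f g : HahnSeries ℤ ℝ) : P ((f - P f) * (g - P g)) = 0 := by
  ext e
  rw [P_coeff]
  split_ifs with h
  · apply mul_coeff_zero
    intro a b hab
    simp only [P_coeff, HahnSeries.coeff_sub]
    by_cases ha : a ≤ 0
    · left; simp [ha]
    · right; rw [if_pos]
      · simp
      · omega
  · rfl

lemma zero_curv (s t X Y : HahnSeries ℤ ℝ) :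
    P (t * (P (s * X) * Y - P (s * Y) * X)) - P (s * (P (t * X) * Y - P (t * Y) * X))
      = P (s * X) * P (t * Y) - P (s * Y) * P (t * X) := by
  have h1 := P_mul_neg (s * X) (t * Y)
  have h2 := P_mul_neg (s * Y) (t * X)
  have h3 := P_mul_pos (s * X) (t * Y)
  have h4 := P_mul_pos (s * Y) (t * X)
  set a := P (s * X)
  set a1 := P (s * Y)
  set b := P (t * X)
  set b1 := P (t * Y)
  have key : t * (a * Y - a1 * X) - s * (b * Y - b1 * X)
      = a * b1 - a1 * b - ((s * X - a) * (t * Y - b1) - (s * Y - a1) * (t * X - b)) := by ring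
  rw [← P_sub, key, P_sub, P_sub, P_sub, h1, h2, h3, h4]; ring

lemma abstract_comm (s t X Y W : HahnSeries ℤ ℝ) :
    P (t * (P (s * X) * Y - P (s * Y) * X)) * Y + P (t * X) * (P (s * X) * W - P (s * W) * X)
      - P (t * (P (s * X) * W - P (s * W) * X)) * X - P (t * Y) * (P (s * X) * Y - P (s * Y) * X)
    = P (s * (P (t * X) * Y - P (t * Y) * X)) * Y + P (s * X) * (P (t * X) * W - P (t * W) * X)
      - P (s * (P (t * X) * W - P (t * W) * X)) * X
      - P (s * Y) * (P (t * X) * Y - P (t * Y) * X) := by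
  have h1 := zero_curv s t X Y
  have h2 := zero_curv s t X W
  linear_combination Y * h1 - X * h2

/-- generating series -/
noncomputable def ser (u : ℕ → ℝ) : HahnSeries ℤ ℝ :=
  HahnSeries.ofPowerSeries ℤ ℝ (PowerSeries.mk u)

lemma ser_coeff (u : ℕ → ℝ) (k : ℕ) : (ser u).coeff (k : ℤ) = u k := by
  have := HahnSeries.ofPowerSeries_apply_coeff (Γ := ℤ) (PowerSeries.mk u) k
  simpa [ser] using this

lemma ser_coeff_neg (u : ℕ → ℝ) (e : ℤ) (he : e < 0) : (ser u).coeff e = 0 := by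
  rw [ser, HahnSeries.ofPowerSeries_apply]
  apply HahnSeries.embDomain_of_notMem_range
  rintro ⟨k, hk⟩
  simp at hk
  omega

/-- the shift `t^{-n}` -/
noncomputable def sh (n : ℕ) : HahnSeries ℤ ℝ := HahnSeries.single (-(n : ℤ)) 1

lemma sh_coeff (n : ℕ) (f : HahnSeries ℤ ℝ) (e : ℤ) :
    (sh n * f).coeff e = f.coeff (e + n) := by
  rw [sh, HahnSeries.coeff_single_mul]; simp

lemma P_sh (n : ℕ) (u : ℕ → ℝ) :
    P (sh n * ser u) = ∑ k ∈ Finset.range (n + 1), HahnSeries.single ((k : ℤ) - n) (u k) := by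
  ext e
  rw [P_coeff, sh_coeff, HahnSeries.coeff_sum]
  by_cases h : 0 ≤ e + n
  · obtain ⟨k, hk⟩ := Int.eq_ofNat_of_zero_le h
    rw [hk, ser_coeff]
    have he : e = (k : ℤ) - n := by omega
    split_ifs with h0
    · rw [Finset.sum_eq_single k]
      · rw [he, HahnSeries.coeff_single_same]
      · intro b _ hb
        rw [HahnSeries.coeff_single_of_ne]; omega
      · intro hk'; simp at hk'; omega
    · symm; apply Finset.sum_eq_zero
      intro b hb
      rw [HahnSeries.coeff_single_of_ne]; simp at hb; omega
  · rw [ser_coeff_neg _ _ (by omega), ite_self]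
    symm; apply Finset.sum_eq_zero
    intro b hb
    rw [HahnSeries.coeff_single_of_ne]; omega

lemma P_sh_mul_coeff (n l : ℕ) (u v : ℕ → ℝ) (hl : 1 ≤ l) :
    (P (sh n * ser u) * ser v).coeff (l : ℤ)
      = ∑ k ∈ Finset.range (n + 1), u k * v (l + n - k) := by
  rw [P_sh, Finset.sum_mul, HahnSeries.coeff_sum]
  apply Finset.sum_congr rfl
  intro k hk
  simp at hk
  rw [HahnSeries.coeff_single_mul, ← ser_coeff v]
  congr 2
  omega

lemma sum_flip (w : ℕ → ℕ → ℝ) (hw : ∀ a b, w a b = - w b a) (n l : ℕ) :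
    ∑ k ∈ Finset.range l, w k (l + n - k) = ∑ k ∈ Finset.range (n + 1), w k (l + n - k) := by
  have h1 := Finset.sum_range_add (fun k => w k (l + n - k)) l (n + 1)
  have h0 : ∑ k ∈ Finset.range (l + (n + 1)), w k (l + n - k) = 0 := by
    have h2 := Finset.sum_range_reflect (fun k => w k (l + n - k)) (l + (n + 1))
    have h3 : ∑ k ∈ Finset.range (l + (n + 1)), w (l + (n+1) - 1 - k) (l + n - (l + (n+1) - 1 - k))
      = - ∑ k ∈ Finset.range (l + (n + 1)), w k (l + n - k) := by
      rw [← Finset.sum_neg_distrib]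
      apply Finset.sum_congr rfl
      intro k hk
      simp at hk
      rw [hw, show l + n - (l + (n+1) - 1 - k) = k by omega,
        show l + (n+1) - 1 - k = l + n - k by omega]
    linarith
  have h4 : ∑ k ∈ Finset.range (n + 1), w (l + k) (l + n - (l + k))
      = - ∑ k ∈ Finset.range (n + 1), w k (l + n - k) := by
    rw [← Finset.sum_range_reflect, ← Finset.sum_neg_distrib]
    apply Finset.sum_congr rfl
    intro k hk
    simp at hk
    rw [hw, show l + n - (l + (n + 1 - 1 - k)) = k by omega,
        show l + (n + 1 - 1 - k) = l + n - k by omega]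
  linarith

/-- bracket sequence -/
noncomputable def br (n : ℕ) (u v : ℕ → ℝ) (l : ℕ) : ℝ :=
  ∑ k ∈ Finset.range l, (u k * v (l + n - k) - u (l + n - k) * v k)

lemma br_coeff (n l : ℕ) (u v : ℕ → ℝ) (hl : 1 ≤ l) :
    (P (sh n * ser u) * ser v - P (sh n * ser v) * ser u).coeff (l : ℤ) = br n u v l := by
  rw [HahnSeries.coeff_sub, P_sh_mul_coeff _ _ _ _ hl, P_sh_mul_coeff _ _ _ _ hl, br,
    sum_flip (fun a b => u a * v b - u b * v a) (fun a b => by ring), ← Finset.sum_sub_distrib]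
  apply Finset.sum_congr rfl
  intro k _
  ring

lemma br_ser (n : ℕ) (u v : ℕ → ℝ) :
    P (sh n * ser u) * ser v - P (sh n * ser v) * ser u = ser (br n u v) := by
  ext e
  by_cases h : 1 ≤ e
  · obtain ⟨l, rfl⟩ := Int.eq_ofNat_of_zero_le (show 0 ≤ e by omega)
    rw [br_coeff _ _ _ _ (by omega), ser_coeff]
  · have hR : (ser (br n u v)).coeff e = 0 := by
      rcases lt_or_ge e 0 with h0 | h0
      · exact ser_coeff_neg _ _ h0
      · have : e = ((0 : ℕ) : ℤ) := by push_cast; omega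
        rw [this, ser_coeff]; simp [br]
    have hz : ∀ a b : ℕ → ℝ, ((sh n * ser a - P (sh n * ser a)) * ser b).coeff e = 0 := by
      intro a b
      apply mul_coeff_zero
      intro c d hcd
      by_cases hc : c ≤ 0
      · left; simp [P_coeff, hc]
      · right; exact ser_coeff_neg _ _ (by omega)
    rw [hR, show P (sh n * ser u) * ser v - P (sh n * ser v) * ser u
      = (sh n * ser v - P (sh n * ser v)) * ser u - (sh n * ser u - P (sh n * ser u)) * ser v by
        ring, HahnSeries.coeff_sub, hz, hz, sub_zero]

/-- linearised vector field -/
noncomputable def lin (n : ℕ) (u v z w : ℕ → ℝ) (l : ℕ) : ℝ :=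
  ∑ k ∈ Finset.range l, (u k * w (l + n - k) + z k * v (l + n - k)
    - u (l + n - k) * w k - z (l + n - k) * v k)

lemma lin_coeff (n l : ℕ) (u v z w : ℕ → ℝ) (hl : 1 ≤ l) :
    (P (sh n * ser z) * ser v + P (sh n * ser u) * ser w
      - P (sh n * ser w) * ser u - P (sh n * ser v) * ser z).coeff (l : ℤ) = lin n u v z w l := by
  simp only [HahnSeries.coeff_sub, HahnSeries.coeff_add, P_sh_mul_coeff _ _ _ _ hl]
  rw [lin, sum_flip (fun a b => u a * w b + z a * v b - u b * w a - z b * v a)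
    (fun a b => by ring), ← Finset.sum_add_distrib, ← Finset.sum_sub_distrib,
    ← Finset.sum_sub_distrib]
  apply Finset.sum_congr rfl
  intro k _
  ring

lemma lin_comm (m n l : ℕ) (u v w : ℕ → ℝ) (hl : 1 ≤ l) :
    lin n u v (br m u v) (br m u w) l = lin m u v (br n u v) (br n u w) l := by
  rw [← lin_coeff _ _ _ _ _ _ hl, ← lin_coeff _ _ _ _ _ _ hl]
  simp only [← br_ser]
  rw [abstract_comm]

lemma sum_Icc_range (w : ℕ → ℝ) (l : ℕ) (hl : 1 ≤ l) :
    ∑ k ∈ Finset.range l, w k = w 0 + ∑ k ∈ Finset.Icc 1 (l - 1), w k := by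
  obtain ⟨L, rfl⟩ : ∃ L, l = L + 1 := ⟨l - 1, by omega⟩
  rw [Finset.sum_range_eq_add_Ico _ (by omega)]
  rfl

/-- replace the zeroth term -/
noncomputable def ext0 (c : ℝ) (u : ℕ → ℝ) (k : ℕ) : ℝ := if k = 0 then c else u k

lemma ext0_zero (c : ℝ) (u : ℕ → ℝ) : ext0 c u 0 = c := rfl
lemma ext0_pos (c : ℝ) (u : ℕ → ℝ) (k : ℕ) (hk : 1 ≤ k) : ext0 c u k = u k := by
  rw [ext0, if_neg]; omega

lemma br_ext (n l : ℕ) (hl : 1 ≤ l) (u v : ℕ → ℝ) :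
    br n (ext0 1 u) (ext0 0 v) l = v (l + (n + 1) - 1)
      + ∑ k ∈ Finset.Icc 1 (l - 1),
        (u k * v (l + (n + 1) - k - 1) - u (l + (n + 1) - k - 1) * v k) := by
  rw [br, sum_Icc_range _ _ hl]
  congr 1
  · rw [ext0_zero, ext0_zero, ext0_pos _ _ _ (by omega)]; simp
  · apply Finset.sum_congr rfl
    intro k hk
    simp at hk
    rw [show l + (n + 1) - k - 1 = l + n - k by omega]
    simp only [ext0_pos _ _ k (by omega), ext0_pos _ _ (l + n - k) (by omega)]

lemma Z_eq (q : ℕ → ℝ → ℝ) (n l : ℕ) (hl : 1 ≤ l) (x : ℝ) :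
    Zfield q (n + 1) l x
      = br n (ext0 1 fun k => q k x) (ext0 0 fun k => deriv (q k) x) l := by
  rw [br_ext _ _ hl, Zfield]

lemma Z_hasDeriv (q : ℕ → ℝ → ℝ) (hq : ∀ m : ℕ, ContDiff ℝ (⊤ : ℕ∞) (q m))
    (n l : ℕ) (hl : 1 ≤ l) (x : ℝ) :
    HasDerivAt (Zfield q (n + 1) l)
      (br n (ext0 1 fun k => q k x) (ext0 0 fun k => deriv (deriv (q k)) x) l) x := by
  have h1 : ∀ m, HasDerivAt (q m) (deriv (q m) x) x := fun m =>
    (((hq m).differentiable (by simp)) x).hasDerivAt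
  have h2 : ∀ m, HasDerivAt (deriv (q m)) (deriv (deriv (q m)) x) x := fun m =>
    ((((contDiff_infty_iff_deriv.1 (hq m)).2).differentiable (by simp)) x).hasDerivAt
  rw [br_ext _ _ hl]
  have := (h2 (l + (n + 1) - 1)).add (HasDerivAt.fun_sum (u := Finset.Icc 1 (l - 1))
    (fun k _ => ((h1 k).mul (h2 (l + (n + 1) - k - 1))).sub
      ((h1 (l + (n + 1) - k - 1)).mul (h2 k))))
  refine HasDerivAt.congr_deriv this ?_
  congr 1
  apply Finset.sum_congr rfl
  intro k _
  ring

lemma main_deriv (q : ℕ → ℝ → ℝ) (hq : ∀ m : ℕ, ContDiff ℝ (⊤ : ℕ∞) (q m))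
    (n m l : ℕ) (hl : 1 ≤ l) (x : ℝ) :
    deriv (fun ε : ℝ => Zfield (fun k y => q k y + ε * Zfield q (m + 1) k y) (n + 1) l x) 0
      = lin n (ext0 1 fun k => q k x) (ext0 0 fun k => deriv (q k) x)
          (br m (ext0 1 fun k => q k x) (ext0 0 fun k => deriv (q k) x))
          (br m (ext0 1 fun k => q k x) (ext0 0 fun k => deriv (deriv (q k)) x)) l := by
  set u := ext0 1 fun k => q k x with hu
  set v := ext0 0 fun k => deriv (q k) x with hv
  set z := br m u v with hz
  set w := br m u (ext0 0 fun k => deriv (deriv (q k)) x) with hw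
  have hz0 : z 0 = 0 := by simp [hz, br]
  have hw0 : w 0 = 0 := by simp [hw, br]
  have hfun : (fun ε : ℝ => Zfield (fun k y => q k y + ε * Zfield q (m + 1) k y) (n + 1) l x)
      = fun ε => ∑ k ∈ Finset.range l, ((u k + ε * z k) * (v (l + n - k) + ε * w (l + n - k))
        - (u (l + n - k) + ε * z (l + n - k)) * (v k + ε * w k)) := by
    funext ε
    rw [Z_eq _ _ _ hl, br]
    have e1 : (ext0 1 fun k => q k x + ε * Zfield q (m + 1) k x) = fun k => u k + ε * z k := by
      funext k
      rcases Nat.eq_zero_or_pos k with rfl | hk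
      · rw [hz0, hu, ext0_zero, ext0_zero]; simp
      · rw [hu, ext0_pos _ _ _ hk, ext0_pos _ _ _ hk, Z_eq _ _ _ hk]
    have e2 : (ext0 0 fun k => deriv (fun y => q k y + ε * Zfield q (m + 1) k y) x)
        = fun k => v k + ε * w k := by
      funext k
      rcases Nat.eq_zero_or_pos k with rfl | hk
      · rw [hw0, hv, ext0_zero, ext0_zero]; simp
      · rw [hv, ext0_pos _ _ _ hk, ext0_pos _ _ _ hk]
        exact (((((hq k).differentiable (by simp)) x).hasDerivAt).add
          ((Z_hasDeriv q hq m k hk x).const_mul ε)).deriv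
    rw [e1, e2]
  rw [hfun]
  have hlin : ∀ a b : ℝ, HasDerivAt (fun ε : ℝ => a + ε * b) b 0 := fun a b => by
    simpa using ((hasDerivAt_id (0 : ℝ)).mul_const b).const_add a
  have := HasDerivAt.fun_sum (u := Finset.range l)
    (fun k _ => ((hlin (u k) (z k)).mul (hlin (v (l + n - k)) (w (l + n - k)))).sub
      ((hlin (u (l + n - k)) (z (l + n - k))).mul (hlin (v k) (w k))))
  refine (HasDerivAt.congr_deriv this ?_).deriv
  rw [lin]
  apply Finset.sum_congr rfl
  intro k _
  ring

end KillingAux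

/-- the infinite Killing hierarchy commutes: for every family `q` of smooth
functions, all `i,j ≥ 1`, every component `l ≥ 1` and every `x`, the two directional
(Gateaux) derivatives agree:
`(d/dε)|₀ (Z_i[q+εZ_j[q]])_l(x) = (d/dε)|₀ (Z_j[q+εZ_i[q]])_l(x)`. -/
theorem infinite_killing_hierarchy_commutes
    (q : ℕ → ℝ → ℝ) (hq : ∀ m : ℕ, ContDiff ℝ (⊤ : ℕ∞) (q m))
    (i j l : ℕ) (hi : 1 ≤ i) (hj : 1 ≤ j) (hl : 1 ≤ l) (x : ℝ) :
    deriv (fun ε : ℝ => Zfield (fun m y => q m y + ε * Zfield q j m y) i l x) 0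
      = deriv (fun ε : ℝ => Zfield (fun m y => q m y + ε * Zfield q i m y) j l x) 0 := by
  obtain ⟨n, rfl⟩ : ∃ n, i = n + 1 := ⟨i - 1, by omega⟩
  obtain ⟨m, rfl⟩ : ∃ m, j = m + 1 := ⟨j - 1, by omega⟩
  rw [KillingAux.main_deriv q hq n m l hl x, KillingAux.main_deriv q hq m n l hl x]
  exact KillingAux.lin_comm m n l _ _ _ hl
end

section
/- Let L be the n×n matrix with entries L_{i1} = −q_i (i = 1,…,n), L_{i,i+1} = 1 (i = 1,…,n−1), and all other entries 0, and define the matrices K_1,…,K_n by K_1 = I and K_{r+1} = L·K_r + q_r·I for r = 1,…,n−1. Then for every q ∈ ℝ^n, every p ∈ ℝ^n and all r,j ∈ {1,…,n}: (K_r·p)_j = p_{j+r−1} + Σ_{k=1}^{j−1} ( q_k·p_{j+r−k−1} − q_{j+r−k−1}·p_k ), where q_α and p_α are read as 0 for α > n. -/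
open scoped BigOperators

/-- The `α`-th component (1-based) of a vector `v ∈ ℝ^n`, read as `0` for `α = 0` or
`α > n`. -/
def vext {n : ℕ} (v : Fin n → ℝ) (α : ℕ) : ℝ :=
  if h : 1 ≤ α ∧ α ≤ n then v ⟨α - 1, by omega⟩ else 0

lemma vext_zero_aux {n : ℕ} (v : Fin n → ℝ) : vext v 0 = 0 := by simp [vext]

lemma vext_big_aux {n : ℕ} (v : Fin n → ℝ) (a : ℕ) (h : n < a) : vext v a = 0 := by
  unfold vext
  rw [dif_neg (by omega)]

lemma sum_antisym_aux {n : ℕ} (q p : Fin n → ℝ) (s m : ℕ) (hm : m ≤ s)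
    (h : m + 1 = s ∨ m = n) :
    ∑ k ∈ Finset.Icc 1 m, (vext q k * vext p (s - k) - vext q (s - k) * vext p k) = 0 := by
  have h1 : ∑ k ∈ Finset.range (s + 1),
      (vext q k * vext p (s - k) - vext q (s - k) * vext p k) = 0 := by
    rw [Finset.sum_sub_distrib, sub_eq_zero, ← Finset.sum_range_reflect]
    apply Finset.sum_congr rfl
    intro k hk
    rw [Finset.mem_range] at hk
    have e1 : s + 1 - 1 - k = s - k := by omega
    have e2 : s - (s - k) = k := by omega
    rw [e1, e2]
  rw [← h1]
  apply Finset.sum_subset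
  · intro k hk
    rw [Finset.mem_Icc] at hk
    rw [Finset.mem_range]
    omega
  · intro k hk hk'
    rw [Finset.mem_range] at hk
    rw [Finset.mem_Icc] at hk'
    by_cases h0 : k = 0
    · subst h0
      rcases h with h | h
      · simp [vext_zero_aux]
      · simp [vext_zero_aux]
    · rcases h with h | h
      · have : s - k = 0 := by omega
        simp [this, vext_zero_aux]
      · simp [vext_big_aux _ k (show n < k by omega)]

lemma Lmat_mulVec_aux {n : ℕ} (q v : Fin n → ℝ) (j : ℕ) (hj : 1 ≤ j) (hj2 : j ≤ n) :
    (Lmat n q).mulVec v ⟨j - 1, by omega⟩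
      = - vext q j * vext v 1 + vext v (j + 1) := by
  have hq : vext q j = q ⟨j - 1, by omega⟩ := by
    unfold vext
    rw [dif_pos ⟨hj, hj2⟩]
  have h1 : vext v 1 = v ⟨0, by omega⟩ := by
    unfold vext
    rw [dif_pos ⟨le_refl 1, by omega⟩]
  have hs : ∀ x : Fin n, Lmat n q ⟨j - 1, by omega⟩ x * v x
      = (if x = ⟨0, by omega⟩ then - vext q j * vext v 1 else 0)
        + (if (x : ℕ) = j then v x else 0) := by
    intro x
    rw [hq, h1]
    simp only [Lmat, Matrix.of_apply, Fin.ext_iff]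
    by_cases hx : (x : ℕ) = 0
    · have : x = ⟨0, by omega⟩ := Fin.ext hx
      rw [if_pos hx, if_pos hx, if_neg (by omega), this, add_zero]
    · have : j - 1 + 1 = j := by omega
      simp [hx, this]
  simp only [Matrix.mulVec, dotProduct]
  rw [Finset.sum_congr rfl (fun x _ => hs x), Finset.sum_add_distrib, Finset.sum_ite_eq']
  simp only [Finset.mem_univ, if_true]
  congr 1
  by_cases h : j < n
  · rw [Finset.sum_eq_single ⟨j, h⟩]
    · unfold vext
      rw [dif_pos ⟨by omega, by omega⟩]
      simp
    · intro b _ hb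
      rw [if_neg]
      intro hb'
      exact hb (Fin.ext hb')
    · simp
  · rw [vext_big_aux _ _ (by omega)]
    apply Finset.sum_eq_zero
    intro x _
    rw [if_neg]
    have := x.2
    omega

/-- if `K₁ = I` and `K_{r+1} = L·K_r + q_r·I` for `r = 1,…,n−1`, then for
every `q, p ∈ ℝ^n` and all `r,j ∈ {1,…,n}`:
`(K_r·p)_j = p_{j+r−1} + Σ_{k=1}^{j−1} (q_k·p_{j+r−k−1} − q_{j+r−k−1}·p_k)`,
where `q_α` and `p_α` are read as `0` for `α > n`. -/
theorem killing_tensor_components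
    (n : ℕ) (hn : 1 ≤ n) (q p : Fin n → ℝ)
    (K : ℕ → Matrix (Fin n) (Fin n) ℝ)
    (hK1 : K 1 = 1)
    (hKrec : ∀ r : ℕ, 1 ≤ r → r ≤ n - 1 →
      K (r + 1) = Lmat n q * K r + vext q r • (1 : Matrix (Fin n) (Fin n) ℝ)) :
    ∀ r j : ℕ, ∀ _ : 1 ≤ r, ∀ hr2 : r ≤ n, ∀ _ : 1 ≤ j, ∀ hj2 : j ≤ n,
      (K r).mulVec p ⟨j - 1, by omega⟩
        = vext p (j + r - 1)
          + ∑ k ∈ Finset.Icc 1 (j - 1),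
              (vext q k * vext p (j + r - k - 1) - vext q (j + r - k - 1) * vext p k) := by
  intro r j hr1
  induction r, hr1 using Nat.le_induction generalizing j with
  | base =>
    intro _ hj hj2
    rw [hK1, Matrix.one_mulVec]
    have e : ∀ k, j + 1 - k - 1 = j - k := by intro k; omega
    simp only [e]
    rw [sum_antisym_aux q p j (j - 1) (by omega) (Or.inl (by omega))]
    unfold vext
    rw [dif_pos ⟨by omega, by omega⟩]
    simp
  | succ r hr ih =>
    intro hr2 hj hj2
    have hv : ∀ a : ℕ, 1 ≤ a → a ≤ n + 1 → vext ((K r).mulVec p) a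
        = vext p (a + r - 1) + ∑ k ∈ Finset.Icc 1 (a - 1),
          (vext q k * vext p (a + r - k - 1) - vext q (a + r - k - 1) * vext p k) := by
      intro a ha ha2
      by_cases h : a ≤ n
      · rw [← ih a (by omega) ha h]
        conv_lhs => unfold vext
        rw [dif_pos ⟨ha, h⟩]
      · have : a = n + 1 := by omega
        subst this
        have e : ∀ k, n + 1 + r - k - 1 = n + r - k := by intro k; omega
        simp only [e]
        rw [vext_big_aux _ _ (by omega), vext_big_aux _ _ (by omega),
          sum_antisym_aux q p (n + r) (n + 1 - 1) (by omega) (Or.inr (by omega))]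
        simp
    have hp : vext p j = p ⟨j - 1, by omega⟩ := by
      unfold vext
      rw [dif_pos ⟨hj, hj2⟩]
    rw [hKrec r hr (by omega), Matrix.add_mulVec, ← Matrix.mulVec_mulVec, Matrix.smul_mulVec,
      Matrix.one_mulVec, Pi.add_apply, Pi.smul_apply, smul_eq_mul, Lmat_mulVec_aux q _ j hj hj2,
      hv 1 le_rfl (by omega), hv (j + 1) (by omega) (by omega), ← hp]
    obtain ⟨i, rfl⟩ : ∃ i, j = i + 1 := ⟨j - 1, by omega⟩
    have e1 : i + 1 + 1 - 1 = i + 1 := by omega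
    rw [e1, Finset.sum_Icc_succ_top (by omega)]
    have e2 : ∀ k, i + 1 + 1 + r - k - 1 = i + 1 + (r + 1) - k - 1 := by intro k; omega
    have e3 : i + 1 + (r + 1) - (i + 1) - 1 = r := by omega
    have e4 : i + 1 + 1 + r - 1 = i + 1 + (r + 1) - 1 := by omega
    have e5 : 1 + r - 1 = r := by omega
    have e6 : i + 1 - 1 = i := by omega
    simp only [e2, e3, e4, e5, e6]
    simp
    ring
end

section
/- Both recursions for the Benenti potentials hold for all integers k: for every k ∈ ℤ, every r ∈ {1,…,n} and every q ∈ U_n, V_r^{(k)} = V_{r+1}^{(k−1)} − q_r·V_1^{(k−1)} and V_r^{(k)} = V_{r−1}^{(k+1)} − (q_{r−1}/q_n)·V_n^{(k+1)} (with q_0 = 1 and V_0^{(k)} = 0). That is, the upward recursion, imposed in the definition only for k ≥ 1, also holds for k ≤ 0, and the downward recursion, imposed only for k ≤ −1, also holds for k ≥ 0. -/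
open scoped BigOperators

theorem ben_out (n : ℕ) (r k : ℤ) (q : Fin n → ℝ) (h : r < 1 ∨ (n : ℤ) < r) :
    benenti n r k q = 0 := by
  rw [benenti, if_pos h]

theorem ben_up (n : ℕ) (r k : ℤ) (q : Fin n → ℝ) (h1 : 1 ≤ r) (h2 : r ≤ n) (hk : 0 < k) :
    benenti n r k q
      = benenti n (r + 1) (k - 1) q - qc n q r * benenti n 1 (k - 1) q := by
  rw [benenti, if_neg (by omega), if_neg (by omega), if_pos hk]

theorem ben_down (n : ℕ) (r k : ℤ) (q : Fin n → ℝ) (h1 : 1 ≤ r) (h2 : r ≤ n) (hk : k < 0) :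
    benenti n r k q
      = benenti n (r - 1) (k + 1) q - (qc n q (r - 1) / qc n q n) * benenti n n (k + 1) q := by
  rw [benenti, if_neg (by omega), if_neg (by omega), if_neg (by omega)]

/-- both the upward and the downward recursions for the Benenti potentials
hold for all integers `k`, for every `r ∈ {1,…,n}` and every `q` with `q_n ≠ 0`. -/
theorem benenti_recursions_all_k
    (n : ℕ) (hn : 1 ≤ n) (k : ℤ) (r : ℕ) (hr1 : 1 ≤ r) (hr2 : r ≤ n)
    (q : Fin n → ℝ) (hq : q ⟨n - 1, by omega⟩ ≠ 0) :
    benenti n r k q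
        = benenti n ((r : ℤ) + 1) (k - 1) q - qc n q r * benenti n 1 (k - 1) q
      ∧ benenti n r k q
        = benenti n ((r : ℤ) - 1) (k + 1) q
            - (qc n q ((r : ℤ) - 1) / qc n q n) * benenti n n (k + 1) q := by
  have hqn : qc n q n ≠ 0 := by
    have e : qc n q n = q ⟨n - 1, by omega⟩ := by
      unfold qc
      rw [if_neg (by omega), dif_pos (by omega)]
      congr 2
      omega
    rw [e]; exact hq
  have hq0 : qc n q 0 = 1 := by simp [qc]
  constructor
  · rcases lt_or_ge 0 k with hk | hk
    · exact ben_up n r k q (by omega) (by omega) hk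
    · have e1 := ben_down n 1 (k - 1) q (by omega) (by omega) (by omega)
      rw [sub_self, sub_add_cancel, hq0, ben_out n 0 k q (by omega)] at e1
      rw [e1]
      rcases Nat.lt_or_ge r n with h | h
      · rw [ben_down n (r + 1) (k - 1) q (by omega) (by omega) (by omega),
          add_sub_cancel_right, sub_add_cancel]
        field_simp
        ring
      · obtain rfl : r = n := by omega
        rw [ben_out r (r + 1) (k - 1) q (by omega)]
        field_simp
        ring
  · rcases lt_or_ge k 0 with hk | hk
    · exact ben_down n r k q (by omega) (by omega) hk
    · have e1 := ben_up n n (k + 1) q (by omega) (by omega) (by omega)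
      rw [add_sub_cancel_right, ben_out n (n + 1) k q (by omega)] at e1
      rw [e1]
      rcases Nat.lt_or_ge 1 r with h | h
      · rw [ben_up n (r - 1) (k + 1) q (by omega) (by omega) (by omega),
          add_sub_cancel_right, sub_add_cancel]
        field_simp
        ring
      · obtain rfl : r = 1 := by omega
        rw [ben_out n _ (k + 1) q (by omega)]
        simp only [Nat.cast_one, sub_self, hq0]
        field_simp
        ring
end

section
/- For every k ∈ {−n,…,n−1} and every point (q_1,…,q_{n+1}) ∈ ℝ^{n+1}: V_1^{n,(n+k)}(q_1,…,q_n) = V_1^{n+1,(n+1+k)}(q_1,…,q_{n+1}); in particular the right-hand side does not depend on q_{n+1}. (All superscripts occurring are nonnegative, so both sides are polynomial functions.) -/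
open scoped BigOperators

theorem ben_succ (n : ℕ) (r : ℤ) (N : ℕ) (q : Fin n → ℝ) (h1 : 1 ≤ r) (h2 : r ≤ n) :
    benenti n r ((N : ℤ) + 1) q = benenti n (r + 1) N q - qc n q r * benenti n 1 N q := by
  rw [benenti, if_neg (by omega), if_neg (by omega), if_pos (by omega)]
  simp

theorem ben_zero (n : ℕ) (r : ℤ) (q : Fin n → ℝ) (h1 : 1 ≤ r) :
    benenti n r 0 q = if r = (n : ℤ) then 1 else 0 := by
  rw [benenti]
  split_ifs <;> first | rfl | omega

theorem ben_big (n : ℕ) (r k : ℤ) (q : Fin n → ℝ) (h1 : (n : ℤ) < r) :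
    benenti n r k q = 0 := by
  rw [benenti, if_pos (Or.inr h1)]

theorem ben_low (n : ℕ) (q : Fin n → ℝ) (N : ℕ) : ∀ r : ℤ, 1 ≤ r → r + N < n →
    benenti n r N q = 0 := by
  induction N with
  | zero =>
    intro r h1 h2
    push_cast at *
    rw [ben_zero n r q h1, if_neg (by omega)]
  | succ N ih =>
    intro r h1 h2
    push_cast at *
    rw [ben_succ n r N q h1 (by omega), ih _ (by omega) (by omega), ih 1 (by omega) (by omega)]
    simp

theorem qc_cast (n : ℕ) (Q : Fin (n + 1) → ℝ) (r : ℤ) (h1 : 1 ≤ r) (h2 : r ≤ n) :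
    qc n (fun i => Q i.castSucc) r = qc (n + 1) Q r := by
  unfold qc
  rw [if_neg (by omega), if_neg (by omega), dif_pos ⟨h1, h2⟩, dif_pos ⟨h1, by push_cast; omega⟩]
  rfl

theorem ben_main (n : ℕ) (hn : 1 ≤ n) (Q : Fin (n + 1) → ℝ) (N : ℕ) :
    ∀ r : ℤ, 1 ≤ r → r ≤ n + 1 → r + N ≤ 2 * n →
    benenti n r N (fun i => Q i.castSucc) = benenti (n + 1) r ((N : ℤ) + 1) Q := by
  induction N with
  | zero =>
    intro r h1 h2 h3
    rw [ben_succ (n + 1) r 0 Q h1 (by push_cast; omega)]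
    push_cast
    rw [ben_zero _ _ _ h1, ben_zero _ _ _ (by omega), ben_zero _ _ _ le_rfl]
    push_cast
    rw [if_neg (c := (1 : ℤ) = n + 1) (by omega)]
    simp
  | succ N ih =>
    intro r h1 h2 h3
    rw [ben_succ (n + 1) r (N + 1) Q h1 (by push_cast; omega)]
    push_cast at *
    rw [← ih 1 (by omega) (by omega) (by omega)]
    by_cases h : r ≤ n
    · rw [ben_succ n r N _ h1 h, ih (r + 1) (by omega) (by omega) (by omega), qc_cast n Q r h1 h]
    · rw [ben_big n r _ _ (by omega), ben_big (n + 1) (r + 1) _ _ (by push_cast; omega),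
        ben_low n _ N 1 le_rfl (by omega)]
      simp

/-- for every `k ∈ {−n,…,n−1}` and every `(q₁,…,q_{n+1}) ∈ ℝ^{n+1}`:
`V₁^{n,(n+k)}(q₁,…,q_n) = V₁^{n+1,(n+1+k)}(q₁,…,q_{n+1})`; in particular the right-hand
side does not depend on `q_{n+1}`. -/
theorem benenti_potential_stabilization
    (n : ℕ) (hn : 1 ≤ n) (k : ℤ) (hk1 : -(n : ℤ) ≤ k) (hk2 : k ≤ (n : ℤ) - 1)
    (Q : Fin (n + 1) → ℝ) :
    benenti n 1 ((n : ℤ) + k) (fun i => Q i.castSucc)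
      = benenti (n + 1) 1 ((n : ℤ) + 1 + k) Q := by
  obtain ⟨N, hN⟩ := Int.eq_ofNat_of_zero_le (show 0 ≤ (n : ℤ) + k by omega)
  have h := ben_main n hn Q N 1 le_rfl (by omega) (by omega)
  rw [hN, show (n : ℤ) + 1 + k = (N : ℤ) + 1 by omega]
  exact h
end
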